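/- Let n, n' ≥ 2 and let X ⊆ (0,∞). Then X has Property (W_n) if and only if X has Property (W_{n'}). -/

import Mathlib

open BoxIntegral

/-- The (closed) set of points of an `n`-dimensional box. -/
def boxSet {n : ℕ} (B : Box (Fin n)) : Set (Fin n → ℝ) :=
  Set.Icc B.lower B.upper

/-- The box `B` has a side whose length belongs to `X`. -/
def hasSideIn {n : ℕ} (X : Set ℝ) (B : Box (Fin n)) : Prop :=
  ∃ i : Fin n, B.upper i - B.lower i ∈ X

/-- `Q` is a partition of `P`: a finite collection of boxes with pairwise disjoint
interiors whose union is `P`. -/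
def isBoxPartition {n k : ℕ} (P : Box (Fin n)) (Q : Fin k → Box (Fin n)) : Prop :=
  (∀ j j' : Fin k, j ≠ j' →
    Disjoint (interior (boxSet (Q j))) (interior (boxSet (Q j')))) ∧
  (⋃ j, boxSet (Q j)) = boxSet P

/-- Property (W_n): for every `n`-dimensional box `P` and every partition of `P`
such that each constituent box has a side with length in `X`, the box `P` itself
has a side with length in `X`. -/
def PropertyW (n : ℕ) (X : Set ℝ) : Prop :=
  ∀ (P : Box (Fin n)) (k : ℕ) (Q : Fin k → Box (Fin n)),
    isBoxPartition P Q → (∀ j, hasSideIn X (Q j)) → hasSideIn X P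


/-- Closure under addition and under the pinwheel operation. -/
structure PinClosed (X : Set ℝ) : Prop where
  add : ∀ u ∈ X, ∀ v ∈ X, u + v ∈ X
  pin : ∀ u ∈ X, ∀ v ∈ X, ∀ w ∈ X, w < u → w < v → u + v - w ∈ X

/-- Reduced (nested) zigzag walks from `0` inside `[0, A]` with steps in `X`;
the two arguments are the last two positions. -/
inductive NestedWalk (X : Set ℝ) (A : ℝ) : ℝ → ℝ → Prop
  | base (d : ℝ) (hd : d ∈ X) (hA : d ≤ A) : NestedWalk X A 0 d
  | down (p q r : ℝ) (h : NestedWalk X A p q) (h1 : p < r) (h2 : r < q) (hr : q - r ∈ X) :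
      NestedWalk X A q r
  | up (p q r : ℝ) (h : NestedWalk X A p q) (h1 : q < r) (h2 : r < p) (hr : r - q ∈ X) :
      NestedWalk X A q r

/-- Positions reachable by nested walks. -/
def Reach (X : Set ℝ) (A x : ℝ) : Prop := x = 0 ∨ ∃ p, NestedWalk X A p x

theorem NestedWalk.bounds {X : Set ℝ} {A : ℝ} (hX : X ⊆ Set.Ioi 0) {p q : ℝ}
    (h : NestedWalk X A p q) :
    0 ≤ p ∧ p ≤ A ∧ 0 < q ∧ q ≤ A ∧ (q = A → A ∈ X) ∧ (p < q → q - p ∈ X)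
      ∧ (q < p → p - q ∈ X) := by
  induction h with
  | base d hd hA =>
    have := hX hd
    simp only [Set.mem_Ioi] at this
    refine ⟨le_rfl, by linarith, this, hA, ?_, ?_, ?_⟩
    · rintro rfl; exact hd
    · intro _; simpa using hd
    · intro; linarith
  | down p q r h h1 h2 hr ih =>
    obtain ⟨a, b, c, d, e, f, g⟩ := ih
    refine ⟨by linarith, by linarith, by linarith, by linarith, ?_, ?_, fun _ => hr⟩
    · intro; linarith
    · intro; linarith
  | up p q r h h1 h2 hr ih =>
    obtain ⟨a, b, c, d, e, f, g⟩ := ih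
    refine ⟨by linarith, by linarith, by linarith, by linarith, ?_, fun _ => hr, ?_⟩
    · intro; linarith
    · intro; linarith

theorem NestedWalk.step {X : Set ℝ} {A : ℝ} (hX : X ⊆ Set.Ioi 0) (hC : PinClosed X) {p q : ℝ}
    (h : NestedWalk X A p q) :
    (∀ s, 0 ≤ s → s ≤ A → (s - q ∈ X ∨ q - s ∈ X) → Reach X A s) ∧
    (∀ s, 0 ≤ s → s ≤ A → (s - p ∈ X ∨ p - s ∈ X) → Reach X A s) := by
  induction h with
  | base d hd hA =>
    have hd0 : 0 < d := hX hd
    constructor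
    · rintro s h0 hs (h | h)
      · refine Or.inr ⟨0, .base s ?_ hs⟩
        have := hC.add _ h _ hd
        simpa using this
      · have h1 : 0 < d - s := hX h
        rcases h0.eq_or_lt with h0 | h0
        · exact Or.inl h0.symm
        · exact Or.inr ⟨d, .down 0 d s (.base d hd hA) h0 (by linarith) h⟩
    · rintro s h0 hs (h | h)
      · exact Or.inr ⟨0, .base s (by simpa using h) hs⟩
      · have h1 : 0 < 0 - s := hX h
        linarith
  | down p q r h h1 h2 hr ih =>
    refine ⟨?_, ih.1⟩
    have hw := NestedWalk.down p q r h h1 h2 hr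
    obtain ⟨-, -, -, -, -, hpq, -⟩ := h.bounds hX
    have hpq := hpq (by linarith)
    rintro s h0 hs (hs' | hs')
    · have h3 : 0 < s - r := hX hs'
      rcases lt_trichotomy s q with h4 | h4 | h4
      · exact Or.inr ⟨r, .up q r s hw (by linarith) h4 hs'⟩
      · subst h4; exact Or.inr ⟨p, h⟩
      · refine ih.2 s h0 hs (Or.inl ?_)
        have := hC.pin _ hpq _ hs' _ hr (by linarith) (by linarith)
        convert this using 1; ring
    · refine ih.1 s h0 hs (Or.inr ?_)
      have := hC.add _ hr _ hs'
      convert this using 1; ring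
  | up p q r h h1 h2 hr ih =>
    refine ⟨?_, ih.1⟩
    have hw := NestedWalk.up p q r h h1 h2 hr
    obtain ⟨-, -, -, -, -, -, hpq⟩ := h.bounds hX
    have hpq := hpq (by linarith)
    rintro s h0 hs (hs' | hs')
    · refine ih.1 s h0 hs (Or.inl ?_)
      have := hC.add _ hr _ hs'
      convert this using 1; ring
    · have h3 : 0 < r - s := hX hs'
      rcases lt_trichotomy q s with h4 | h4 | h4
      · exact Or.inr ⟨r, .down q r s hw h4 (by linarith) hs'⟩
      · subst h4; exact Or.inr ⟨p, h⟩
      · refine ih.2 s h0 hs (Or.inr ?_)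
        have := hC.pin _ hpq _ hs' _ hr (by linarith) (by linarith)
        convert this using 1; ring

theorem Reach.step {X : Set ℝ} {A : ℝ} (hX : X ⊆ Set.Ioi 0) (hC : PinClosed X) {x s : ℝ}
    (h : Reach X A x) (h0 : 0 ≤ s) (hs : s ≤ A) (hd : s - x ∈ X ∨ x - s ∈ X) :
    Reach X A s := by
  rcases h with rfl | ⟨p, h⟩
  · rcases hd with h | h
    · exact Or.inr ⟨0, .base s (by simpa using h) hs⟩
    · have h1 : 0 < 0 - s := hX h
      linarith
  · exact (h.step hX hC).1 s h0 hs hd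

theorem interior_boxSet {n : ℕ} (B : Box (Fin n)) :
    interior (boxSet B) = {x | ∀ i, B.lower i < x i ∧ x i < B.upper i} := by
  unfold boxSet
  rw [← Set.pi_univ_Icc, interior_pi_set Set.finite_univ]
  ext x
  simp [interior_Icc]

open Classical in
/-- The box function `∏ (g i upper - g i lower)` is box additive. -/
noncomputable def prodMap {n : ℕ} (g : Fin n → ℝ → ℝ) : BoxAdditiveMap (Fin n) ℝ ⊤ :=
  BoxAdditiveMap.ofMapSplitAdd (fun I => ∏ i, (g i (I.upper i) - g i (I.lower i))) ⊤ (by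
    intro I _ i x hx
    rw [Box.splitLower_def hx, Box.splitUpper_def hx]
    show (∏ j, (g j (Function.update I.upper i x j) - g j (I.lower j)))
      + (∏ j, (g j (I.upper j) - g j (Function.update I.lower i x j))) = _
    rw [← Finset.mul_prod_erase Finset.univ _ (Finset.mem_univ i),
      ← Finset.mul_prod_erase Finset.univ (fun j => g j (I.upper j) - g j (Function.update I.lower i x j)) (Finset.mem_univ i),
      ← Finset.mul_prod_erase Finset.univ (fun j => g j (I.upper j) - g j (I.lower j)) (Finset.mem_univ i)]
    have e1 : ∏ j ∈ Finset.univ.erase i, (g j (Function.update I.upper i x j) - g j (I.lower j))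
        = ∏ j ∈ Finset.univ.erase i, (g j (I.upper j) - g j (I.lower j)) := by
      refine Finset.prod_congr rfl fun j hj => ?_
      rw [Function.update_of_ne (Finset.ne_of_mem_erase hj)]
    have e2 : ∏ j ∈ Finset.univ.erase i, (g j (I.upper j) - g j (Function.update I.lower i x j))
        = ∏ j ∈ Finset.univ.erase i, (g j (I.upper j) - g j (I.lower j)) := by
      refine Finset.prod_congr rfl fun j hj => ?_
      rw [Function.update_of_ne (Finset.ne_of_mem_erase hj)]
    rw [e1, e2]
    simp only [Function.update_self]
    ring)

theorem prodMap_apply {n : ℕ} (g : Fin n → ℝ → ℝ) (I : Box (Fin n)) :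
    prodMap g I = ∏ i, (g i (I.upper i) - g i (I.lower i)) := rfl

theorem tile_le {n k : ℕ} {P : Box (Fin n)} {Q : Fin k → Box (Fin n)}
    (h : isBoxPartition P Q) (j : Fin k) : Q j ≤ P := by
  rw [Box.le_iff_Icc]
  intro x hx
  have : x ∈ boxSet P := by
    rw [← h.2]; exact Set.mem_iUnion.2 ⟨j, hx⟩
  exact this

open Classical in
/-- A closed-box partition gives a half-open prepartition. -/
noncomputable def toPrepartition {n k : ℕ} {P : Box (Fin n)} {Q : Fin k → Box (Fin n)}
    (h : isBoxPartition P Q) : Prepartition P where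
  boxes := Finset.univ.image Q
  le_of_mem' := by
    intro J hJ
    obtain ⟨j, -, rfl⟩ := Finset.mem_image.1 hJ
    exact tile_le h j
  pairwiseDisjoint := by
    intro J hJ J' hJ' hne
    simp only [Finset.coe_image, Finset.coe_univ, Set.image_univ, Set.mem_range] at hJ hJ'
    obtain ⟨j, rfl⟩ := hJ
    obtain ⟨j', rfl⟩ := hJ'
    have hd := h.1 j j' (fun e => hne (by rw [e]))
    rw [interior_boxSet, interior_boxSet, Set.disjoint_left] at hd
    show Disjoint ((Q j : Set (Fin n → ℝ))) (Q j')
    rw [Set.disjoint_left]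
    intro y hy hy'
    have hz : ∀ i, ∃ z, max ((Q j).lower i) ((Q j').lower i) < z ∧
        z < min ((Q j).upper i) ((Q j').upper i) := fun i =>
      exists_between (lt_of_lt_of_le (max_lt (hy i).1 (hy' i).1) (le_min (hy i).2 (hy' i).2))
    choose z hz using hz
    refine hd (a := z) (fun i => ?_) (fun i => ?_)
    · exact ⟨(max_lt_iff.1 (hz i).1).1, (lt_min_iff.1 (hz i).2).1⟩
    · exact ⟨(max_lt_iff.1 (hz i).1).2, (lt_min_iff.1 (hz i).2).2⟩

theorem toPrepartition_isPartition {n k : ℕ} {P : Box (Fin n)} {Q : Fin k → Box (Fin n)}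
    (h : isBoxPartition P Q) : (toPrepartition h).IsPartition := by
  intro x hx
  have ev : ∀ c : ℝ, 0 < c → ∀ᶠ t in nhdsWithin (0 : ℝ) (Set.Ioi 0), t < c := fun c hc =>
    nhdsWithin_le_nhds (eventually_lt_nhds hc)
  have e1 : ∀ᶠ t in nhdsWithin (0 : ℝ) (Set.Ioi 0), ∀ i, t < x i - P.lower i :=
    Filter.eventually_all.2 fun i => ev _ (sub_pos.2 (hx i).1)
  have e2 : ∀ᶠ t in nhdsWithin (0 : ℝ) (Set.Ioi 0), ∀ j i, (Q j).upper i < x i →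
      t < x i - (Q j).upper i := by
    refine Filter.eventually_all.2 fun j => Filter.eventually_all.2 fun i => ?_
    by_cases hc : (Q j).upper i < x i
    · filter_upwards [ev _ (sub_pos.2 hc)] with t ht _ using ht
    · exact Filter.Eventually.of_forall fun t h => absurd h hc
  have e3 : ∀ᶠ t in nhdsWithin (0 : ℝ) (Set.Ioi 0), 0 < t := self_mem_nhdsWithin
  obtain ⟨t, ⟨h1, h2⟩, h3⟩ := ((e1.and e2).and e3).exists
  have hm : (fun i => x i - t) ∈ boxSet P := by
    refine ⟨fun i => ?_, fun i => ?_⟩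
    · have := h1 i
      show P.lower i ≤ x i - t
      linarith
    · have := (hx i).2
      show x i - t ≤ P.upper i
      linarith
  rw [← h.2] at hm
  obtain ⟨j, hj⟩ := Set.mem_iUnion.1 hm
  refine ⟨Q j, by simp [toPrepartition, ← Prepartition.mem_boxes], fun i => ⟨?_, ?_⟩⟩
  · have : (Q j).lower i ≤ x i - t := hj.1 i
    linarith
  · have : x i - t ≤ (Q j).upper i := hj.2 i
    by_contra hc
    have := h2 j i (not_le.1 hc)
    linarith

open Classical in
theorem PinClosed.propertyW {X : Set ℝ} (hX : X ⊆ Set.Ioi 0) (hC : PinClosed X) (n : ℕ) :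
    PropertyW n X := by
  intro P k Q hQ hside
  by_contra hP
  let g : Fin n → ℝ → ℝ := fun i x =>
    if Reach X (P.upper i - P.lower i) (x - P.lower i) then 1 else 0
  have hsum := (prodMap g).sum_partition_boxes (I := P) le_top (toPrepartition_isPartition hQ)
  have hzero : ∑ J ∈ (toPrepartition hQ).boxes, prodMap g J = 0 := by
    refine Finset.sum_eq_zero fun J hJ => ?_
    obtain ⟨j, -, rfl⟩ := Finset.mem_image.1 hJ
    obtain ⟨i, hi⟩ := hside j
    have hle := Box.le_iff_bounds.1 (tile_le hQ j)
    have l1 := hle.1 i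
    have l2 := hle.2 i
    have l3 := (Q j).lower_lt_upper i
    rw [prodMap_apply]
    refine Finset.prod_eq_zero (Finset.mem_univ i) ?_
    have : Reach X (P.upper i - P.lower i) ((Q j).upper i - P.lower i) ↔
        Reach X (P.upper i - P.lower i) ((Q j).lower i - P.lower i) := by
      constructor
      · intro h
        exact h.step hX hC (by linarith) (by linarith) (Or.inr (by simpa using hi))
      · intro h
        exact h.step hX hC (by linarith) (by linarith) (Or.inl (by simpa using hi))
    simp only [g, this, sub_self]
  rw [hzero, prodMap_apply] at hsum
  obtain ⟨i, -, hi⟩ := Finset.prod_eq_zero_iff.1 hsum.symm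
  have r0 : Reach X (P.upper i - P.lower i) (P.lower i - P.lower i) := Or.inl (sub_self _)
  have r1 : ¬ Reach X (P.upper i - P.lower i) (P.upper i - P.lower i) := by
    have := P.lower_lt_upper i
    rintro (h | ⟨p, h⟩)
    · linarith
    · exact hP ⟨i, (h.bounds hX).2.2.2.2.1 rfl⟩
  simp only [g, if_pos r0, if_neg r1] at hi
  norm_num at hi

/-- The box `[a,b] × [c,d] × [0,A]^m`. -/
def pinBox (m : ℕ) (A a b c d : ℝ) (hA : 0 < A) (hab : a < b) (hcd : c < d) :
    Box (Fin (m + 2)) where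
  lower := Fin.cons a (Fin.cons c (fun _ => 0))
  upper := Fin.cons b (Fin.cons d (fun _ => A))
  lower_lt_upper := by
    intro i
    refine Fin.cases ?_ (fun i => Fin.cases ?_ (fun i => ?_) i) i
    · simpa using hab
    · simpa using hcd
    · simpa using hA

theorem mem_pinBox {m : ℕ} {A a b c d : ℝ} {hA : 0 < A} {hab : a < b} {hcd : c < d}
    (x : Fin (m + 2) → ℝ) : x ∈ boxSet (pinBox m A a b c d hA hab hcd) ↔
      (a ≤ x 0 ∧ x 0 ≤ b) ∧ (c ≤ x 1 ∧ x 1 ≤ d) ∧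
        ∀ i : Fin m, 0 ≤ x i.succ.succ ∧ x i.succ.succ ≤ A := by
  simp only [boxSet, pinBox, Set.mem_Icc, Pi.le_def, Fin.forall_fin_succ, Fin.cons_zero,
    Fin.cons_succ, Fin.succ_zero_eq_one]
  constructor
  · rintro ⟨⟨h1, h2, h3⟩, h4, h5, h6⟩
    exact ⟨⟨h1, h4⟩, ⟨h2, h5⟩, fun i => ⟨h3 i, h6 i⟩⟩
  · rintro ⟨⟨h1, h4⟩, ⟨h2, h5⟩, h⟩
    exact ⟨⟨h1, h2, fun i => (h i).1⟩, h4, h5, fun i => (h i).2⟩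

theorem disj_pinBox {m : ℕ} {A a b c d a' b' c' d' : ℝ} {hA : 0 < A} {hab : a < b} {hcd : c < d}
    {hab' : a' < b'} {hcd' : c' < d'} (h : b ≤ a' ∨ b' ≤ a ∨ d ≤ c' ∨ d' ≤ c) :
    Disjoint (interior (boxSet (pinBox m A a b c d hA hab hcd)))
      (interior (boxSet (pinBox m A a' b' c' d' hA hab' hcd'))) := by
  rw [interior_boxSet, interior_boxSet, Set.disjoint_left]
  intro x hx hx'
  have h0 : a < x 0 ∧ x 0 < b := hx 0
  have h1 : c < x 1 ∧ x 1 < d := hx 1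
  have h0' : a' < x 0 ∧ x 0 < b' := hx' 0
  have h1' : c' < x 1 ∧ x 1 < d' := hx' 1
  rcases h with h | h | h | h <;> linarith [h0.1, h0.2, h1.1, h1.2, h0'.1, h0'.2, h1'.1, h1'.2]

theorem side_cube {m : ℕ} {X : Set ℝ} {A : ℝ} {hA : 0 < A}
    (h : hasSideIn X (pinBox m A 0 A 0 A hA hA hA)) : A ∈ X := by
  obtain ⟨i, hi⟩ := h
  revert hi
  refine Fin.cases ?_ (fun i => Fin.cases ?_ (fun i => ?_) i) i <;> simp [pinBox]

theorem side_zero {m : ℕ} {X : Set ℝ} {A a b c d : ℝ} {hA : 0 < A} {hab : a < b} {hcd : c < d}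
    (h : b - a ∈ X) : hasSideIn X (pinBox m A a b c d hA hab hcd) := ⟨0, h⟩

theorem side_one {m : ℕ} {X : Set ℝ} {A a b c d : ℝ} {hA : 0 < A} {hab : a < b} {hcd : c < d}
    (h : d - c ∈ X) : hasSideIn X (pinBox m A a b c d hA hab hcd) := ⟨1, h⟩

theorem PropertyW.pinClosed {m : ℕ} {X : Set ℝ} (hX : X ⊆ Set.Ioi 0)
    (hW : PropertyW (m + 2) X) : PinClosed X := by
  constructor
  · intro u hu v hv
    have hu0 : 0 < u := hX hu
    have hv0 : 0 < v := hX hv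
    have hA : 0 < u + v := by linarith
    have hb : u < u + v := by linarith
    refine side_cube (m := m) (hA := hA) (hW _ 2
      ![pinBox m (u + v) 0 u 0 (u + v) hA hu0 hA,
        pinBox m (u + v) u (u + v) 0 (u + v) hA hb hA] ⟨?_, ?_⟩ ?_)
    · intro j j' hj
      fin_cases j <;> fin_cases j' <;> first | exact absurd rfl hj | skip
      all_goals
        refine disj_pinBox (hA := ?_) (hab := ?_) (hcd := ?_) (hab' := ?_) (hcd' := ?_) ?_
        any_goals assumption
        simp
    · ext x
      simp only [Set.mem_iUnion, Fin.exists_fin_two, Matrix.cons_val_zero, Matrix.cons_val_one,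
        mem_pinBox]
      constructor
      · rintro (⟨h1, h2, h3⟩ | ⟨h1, h2, h3⟩)
        · exact ⟨⟨h1.1, by linarith⟩, h2, h3⟩
        · exact ⟨⟨by linarith, h1.2⟩, h2, h3⟩
      · rintro ⟨h1, h2, h3⟩
        rcases le_total (x 0) u with h | h
        · exact Or.inl ⟨⟨h1.1, h⟩, h2, h3⟩
        · exact Or.inr ⟨⟨h, h1.2⟩, h2, h3⟩
    · intro j
      fin_cases j
      · exact side_zero (hA := hA) (hab := hu0) (hcd := hA) (by simpa using hu)
      · exact side_zero (hA := hA) (hab := hb) (hcd := hA) (by simpa using hv)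
  · intro u hu v hv w hw hwu hwv
    have hw0 : 0 < w := hX hw
    obtain ⟨a, ha⟩ : ∃ a, a = u - w := ⟨_, rfl⟩
    obtain ⟨A, hAe⟩ : ∃ A, A = u + v - w := ⟨_, rfl⟩
    rw [← hAe]
    have hA : 0 < A := by linarith
    have ha0 : 0 < a := by linarith
    have hau : a < u := by linarith
    have hu0 : 0 < u := by linarith
    have huA : u < A := by linarith
    have haA : a < A := by linarith
    refine side_cube (m := m) (hA := hA) (hW _ 5
      ![pinBox m A 0 u 0 a hA hu0 ha0,
        pinBox m A u A 0 u hA huA hu0,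
        pinBox m A a A u A hA haA huA,
        pinBox m A 0 a a A hA ha0 haA,
        pinBox m A a u a u hA hau hau] ⟨?_, ?_⟩ ?_)
    · intro j j' hj
      fin_cases j <;> fin_cases j' <;> first | exact absurd rfl hj | skip
      all_goals
        refine disj_pinBox (hA := ?_) (hab := ?_) (hcd := ?_) (hab' := ?_) (hcd' := ?_) ?_
        any_goals assumption
        simp only [le_refl, hau.le, true_or, or_true]
    · ext x
      have hex : ∀ p : Fin 5 → Prop, (∃ j, p j) ↔ p 0 ∨ p 1 ∨ p 2 ∨ p 3 ∨ p 4 := by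
        intro p
        simp [Fin.exists_fin_succ]
      rw [Set.mem_iUnion, hex]
      show (x ∈ boxSet (pinBox m A 0 u 0 a hA hu0 ha0) ∨
        x ∈ boxSet (pinBox m A u A 0 u hA huA hu0) ∨
        x ∈ boxSet (pinBox m A a A u A hA haA huA) ∨
        x ∈ boxSet (pinBox m A 0 a a A hA ha0 haA) ∨
        x ∈ boxSet (pinBox m A a u a u hA hau hau)) ↔ _
      simp only [mem_pinBox]
      constructor
      · rintro (⟨h1, h2, h3⟩ | ⟨h1, h2, h3⟩ | ⟨h1, h2, h3⟩ | ⟨h1, h2, h3⟩ | ⟨h1, h2, h3⟩) <;>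
          exact ⟨⟨by linarith, by linarith⟩, ⟨by linarith, by linarith⟩, h3⟩
      · rintro ⟨h1, h2, h3⟩
        simp only [h3, implies_true, and_true]
        rcases le_total (x 0) a with p | p <;> rcases le_total (x 0) u with q | q <;>
        rcases le_total (x 1) a with r | r <;> rcases le_total (x 1) u with s | s <;>
          first
          | exact Or.inl ⟨⟨by linarith, by linarith⟩, by linarith, by linarith⟩
          | exact Or.inr (Or.inl ⟨⟨by linarith, by linarith⟩, by linarith, by linarith⟩)
          | exact Or.inr (Or.inr (Or.inl ⟨⟨by linarith, by linarith⟩, by linarith, by linarith⟩))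
          | exact Or.inr (Or.inr (Or.inr (Or.inl
              ⟨⟨by linarith, by linarith⟩, by linarith, by linarith⟩)))
          | exact Or.inr (Or.inr (Or.inr (Or.inr
              ⟨⟨by linarith, by linarith⟩, by linarith, by linarith⟩)))
    · have e1 : A - a = v := by rw [hAe, ha]; ring
      have e2 : u - a = w := by rw [ha]; ring
      intro j
      fin_cases j
      · exact side_zero (hA := hA) (hab := hu0) (hcd := ha0) (by simpa using hu)
      · exact side_one (hA := hA) (hab := huA) (hcd := hu0) (by simpa using hu)
      · exact side_zero (hA := hA) (hab := haA) (hcd := huA) (by rw [e1]; exact hv)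
      · exact side_one (hA := hA) (hab := ha0) (hcd := haA) (by rw [e1]; exact hv)
      · exact side_one (hA := hA) (hab := hau) (hcd := hau) (by rw [e2]; exact hw)

theorem propertyW_iff_propertyW (n n' : ℕ) (hn : 2 ≤ n) (hn' : 2 ≤ n')
    (X : Set ℝ) (hX : X ⊆ Set.Ioi 0) :
    PropertyW n X ↔ PropertyW n' X := by
  obtain ⟨m, rfl⟩ := Nat.exists_eq_add_of_le' hn
  obtain ⟨m', rfl⟩ := Nat.exists_eq_add_of_le' hn'
  exact ⟨fun h => (h.pinClosed hX).propertyW hX _, fun h => (h.pinClosed hX).propertyW hX _⟩
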